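/- Let C be a coalgebra, F_0 a full set of simple C-comodules (one from each isomorphism class), and F a corresponding set of indecomposable injective covers, i.e. indecomposable injective comodules whose socles are the members of F_0. Then C is spanned by the coefficients of the members of F: C = Σ_{I∈F} φ_I(I*⊗I), where φ_I is the coefficient map of I. -/

import Mathlib

open TensorProduct

namespace SuperCoalg

variable (k : Type) [Field k]
variable (C : Type) [AddCommGroup C] [Module k C] [Coalgebra k C]

/-- `β : V →ₗ[k] V ⊗[k] C` is a (right) comodule structure map over the coalgebra `C`. -/
structure IsComodule {V : Type} [AddCommGroup V] [Module k V]
    (β : V →ₗ[k] V ⊗[k] C) : Prop where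
  coassoc : (TensorProduct.assoc k V C C).toLinearMap ∘ₗ β.rTensor C ∘ₗ β
      = LinearMap.lTensor V (Coalgebra.comul (R := k) (A := C)) ∘ₗ β
  counit_id : (TensorProduct.rid k V).toLinearMap ∘ₗ
      LinearMap.lTensor V (Coalgebra.counit (R := k) (A := C)) ∘ₗ β = LinearMap.id

/-- A bundled right `C`-comodule. -/
structure Comod where
  V : Type
  [addCommGroup : AddCommGroup V]
  [module : Module k V]
  β : V →ₗ[k] V ⊗[k] C
  isComodule : IsComodule k C β

attribute [instance] Comod.addCommGroup Comod.module

variable {k C}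

/-- A submodule `W ≤ V` is a subcomodule for the structure map `β`. -/
def IsSubcomodule {V : Type} [AddCommGroup V] [Module k V]
    (β : V →ₗ[k] V ⊗[k] C) (W : Submodule k V) : Prop :=
  ∀ w ∈ W, β w ∈ LinearMap.range (W.subtype.rTensor C)

/-- `f` is a homomorphism of right `C`-comodules from `(V, β)` to `(W, γ)`. -/
def IsComodHom {V W : Type} [AddCommGroup V] [Module k V] [AddCommGroup W] [Module k W]
    (β : V →ₗ[k] V ⊗[k] C) (γ : W →ₗ[k] W ⊗[k] C) (f : V →ₗ[k] W) : Prop :=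
  f.rTensor C ∘ₗ β = γ ∘ₗ f

/-- A subcomodule is simple if it is nonzero and has no nonzero proper subcomodules. -/
def IsSimpleSubcomodule {V : Type} [AddCommGroup V] [Module k V]
    (β : V →ₗ[k] V ⊗[k] C) (W : Submodule k V) : Prop :=
  IsSubcomodule β W ∧ W ≠ ⊥ ∧
    ∀ U : Submodule k V, U ≤ W → IsSubcomodule β U → U = ⊥ ∨ U = W

/-- The socle of the comodule `(V, β)`: the sum of all its simple subcomodules. -/
def socle {V : Type} [AddCommGroup V] [Module k V]
    (β : V →ₗ[k] V ⊗[k] C) : Submodule k V :=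
  sSup {W : Submodule k V | IsSimpleSubcomodule β W}

/-- A comodule is simple if it is nonzero and has no nonzero proper subcomodules. -/
def IsSimpleComod (M : Comod k C) : Prop :=
  Nontrivial M.V ∧ ∀ W : Submodule k M.V, IsSubcomodule M.β W → W = ⊥ ∨ W = ⊤

/-- A comodule is indecomposable if it is nonzero and is not the direct sum of two
nonzero subcomodules. -/
def IsIndecomposableComod (M : Comod k C) : Prop :=
  Nontrivial M.V ∧ ∀ W W' : Submodule k M.V,
    IsSubcomodule M.β W → IsSubcomodule M.β W' → IsCompl W W' → W = ⊥ ∨ W' = ⊥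

/-- A comodule is injective if it splits off every comodule containing it as a
subcomodule. -/
def IsInjectiveComod (M : Comod k C) : Prop :=
  ∀ (W : Comod k C) (g : M.V →ₗ[k] W.V),
    IsComodHom M.β W.β g → Function.Injective g →
      ∃ X' : Submodule k W.V, IsSubcomodule W.β X' ∧ IsCompl (LinearMap.range g) X'

/-- `N` is an injective cover of the simple comodule `S`: `N` is indecomposable,
injective, and its socle is a copy of `S`. -/
def IsInjectiveCover (N S : Comod k C) : Prop :=
  IsIndecomposableComod N ∧ IsInjectiveComod N ∧
    ∃ g : S.V →ₗ[k] N.V, IsComodHom S.β N.β g ∧ Function.Injective g ∧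
      LinearMap.range g = socle N.β

/-- The coefficient map `φ_V : V* ⊗ V → C` of a comodule `(V, β)`, given by right linear
extension of forms, `φ_V (ω ⊗ v) = (ω ⊗ id) (β v)`. -/
noncomputable def coeffMap {V : Type} [AddCommGroup V] [Module k V]
    (β : V →ₗ[k] V ⊗[k] C) : (Module.Dual k V) ⊗[k] V →ₗ[k] C :=
  (TensorProduct.lid k C).toLinearMap ∘ₗ
    (contractLeft k V).rTensor C ∘ₗ
    (TensorProduct.assoc k (Module.Dual k V) V C).symm.toLinearMap ∘ₗ
    LinearMap.lTensor (Module.Dual k V) β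

/-- slice map -/
noncomputable def act {V D : Type} [AddCommGroup V] [Module k V] [AddCommGroup D] [Module k D]
    (f : D →ₗ[k] k) : V ⊗[k] D →ₗ[k] V :=
  (TensorProduct.rid k V).toLinearMap ∘ₗ LinearMap.lTensor V f

section slices
variable {V W D : Type} [AddCommGroup V] [Module k V] [AddCommGroup W] [Module k W]
  [AddCommGroup D] [Module k D]

theorem act_tmul (f : D →ₗ[k] k) (v : V) (d : D) : act f (v ⊗ₜ[k] d) = f d • v := by
  simp [act]

theorem act_rTensor (f : D →ₗ[k] k) (h : V →ₗ[k] W) (x : V ⊗[k] D) :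
    act f (h.rTensor D x) = h (act f x) := by
  induction x with
  | zero => simp
  | tmul v d => simp [act_tmul]
  | add x y hx hy => simp [hx, hy]

theorem act_sep (x : V ⊗[k] D) (h : ∀ f : D →ₗ[k] k, act f x = 0) : x = 0 := by
  classical
  let b := Module.Basis.ofVectorSpace k D
  apply (TensorProduct.equivFinsuppOfBasisRight b (M := V)).injective
  rw [map_zero]
  ext i
  have key : ∀ y : V ⊗[k] D, TensorProduct.equivFinsuppOfBasisRight b y i
      = act (b.coord i) y := by
    intro y
    induction y with
    | zero => simp
    | tmul v d => simp [act_tmul, TensorProduct.equivFinsuppOfBasisRight_apply_tmul_apply]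
    | add x y hx hy => simp [hx, hy]
  rw [key, h]; rfl

theorem mem_range_iff (U : Submodule k V) (x : V ⊗[k] D) :
    x ∈ LinearMap.range (U.subtype.rTensor D) ↔ ∀ f : D →ₗ[k] k, act f x ∈ U := by
  constructor
  · rintro ⟨y, rfl⟩ f
    rw [act_rTensor]; exact (act f y).2
  · intro h
    have ex : Function.Exact (U.subtype.rTensor D) (U.mkQ.rTensor D) :=
      rTensor_exact D (LinearMap.exact_subtype_mkQ U) U.mkQ_surjective
    refine (ex x).1 (act_sep _ fun f => ?_)
    rw [act_rTensor]
    simpa using h f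

theorem rTensor_inj (h : V →ₗ[k] W) (hh : Function.Injective h) :
    Function.Injective (h.rTensor D) :=
  Module.Flat.rTensor_preserves_injective_linearMap h hh

end slices

theorem assoc_nat {V W : Type} [AddCommGroup V] [Module k V] [AddCommGroup W] [Module k W]
    (h : V →ₗ[k] W) (x : (V ⊗[k] C) ⊗[k] C) :
    h.rTensor (C ⊗[k] C) (TensorProduct.assoc k V C C x)
      = TensorProduct.assoc k W C C ((h.rTensor C).rTensor C x) := by
  have : h.rTensor (C ⊗[k] C) ∘ₗ (TensorProduct.assoc k V C C).toLinearMap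
      = (TensorProduct.assoc k W C C).toLinearMap ∘ₗ (h.rTensor C).rTensor C := by
    ext; simp
  exact LinearMap.congr_fun this x

theorem lr_comm {V W D E : Type} [AddCommGroup V] [Module k V] [AddCommGroup W] [Module k W]
    [AddCommGroup D] [Module k D] [AddCommGroup E] [Module k E]
    (h : V →ₗ[k] W) (g : D →ₗ[k] E) (x : V ⊗[k] D) :
    h.rTensor E (g.lTensor V x) = g.lTensor W (h.rTensor D x) := by
  have : h.rTensor E ∘ₗ g.lTensor V = g.lTensor W ∘ₗ h.rTensor D := by
    ext; simp
  exact LinearMap.congr_fun this x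

theorem coassoc_ap {V : Type} [AddCommGroup V] [Module k V] {β : V →ₗ[k] V ⊗[k] C}
    (hβ : IsComodule k C β) (v : V) :
    TensorProduct.assoc k V C C (β.rTensor C (β v))
      = LinearMap.lTensor V (Coalgebra.comul (R := k) (A := C)) (β v) :=
  LinearMap.congr_fun hβ.coassoc v

theorem counit_ap {V : Type} [AddCommGroup V] [Module k V] {β : V →ₗ[k] V ⊗[k] C}
    (hβ : IsComodule k C β) (v : V) :
    act (Coalgebra.counit (R := k) (A := C)) (β v) = v :=
  LinearMap.congr_fun hβ.counit_id v

theorem self_isComodule : IsComodule k C (Coalgebra.comul (R := k) (A := C)) where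
  coassoc := Coalgebra.coassoc
  counit_id := by
    ext c
    simp

section restrict
variable {V : Type} [AddCommGroup V] [Module k V] {β : V →ₗ[k] V ⊗[k] C}

theorem exists_restrict (hβ : IsComodule k C β) (W : Submodule k V) (hW : IsSubcomodule β W) :
    ∃ γ : W →ₗ[k] W ⊗[k] C, IsComodule k C γ ∧ ∀ w : W, W.subtype.rTensor C (γ w) = β w := by
  have inj : Function.Injective (W.subtype.rTensor C) := rTensor_inj _ W.subtype_injective
  let γ : W →ₗ[k] W ⊗[k] C := (LinearEquiv.ofInjective _ inj).symm.toLinearMap ∘ₗ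
    LinearMap.codRestrict _ (β ∘ₗ W.subtype) (fun w => hW w w.2)
  have hγ : ∀ w : W, W.subtype.rTensor C (γ w) = β w := by
    intro w
    have := congrArg Subtype.val ((LinearEquiv.ofInjective _ inj).apply_symm_apply
      (LinearMap.codRestrict _ (β ∘ₗ W.subtype) (fun w => hW w w.2) w))
    exact this
  have hγ' : W.subtype.rTensor C ∘ₗ γ = β ∘ₗ W.subtype := LinearMap.ext hγ
  refine ⟨γ, ⟨?_, ?_⟩, hγ⟩
  · ext1 w
    apply rTensor_inj (D := C ⊗[k] C) W.subtype W.subtype_injective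
    simp only [LinearMap.comp_apply, LinearEquiv.coe_coe]
    rw [assoc_nat, lr_comm, hγ, ← LinearMap.comp_apply ((W.subtype.rTensor C).rTensor C),
      ← LinearMap.rTensor_comp, hγ', LinearMap.rTensor_comp, LinearMap.comp_apply, hγ,
      coassoc_ap hβ]
  · ext1 w
    apply W.subtype_injective
    change W.subtype (act _ (γ w)) = w
    rw [← act_rTensor, hγ, counit_ap hβ]
end restrict

/-- cofree coaction -/
noncomputable def cofree (V : Type) [AddCommGroup V] [Module k V] :
    V ⊗[k] C →ₗ[k] (V ⊗[k] C) ⊗[k] C :=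
  (TensorProduct.assoc k V C C).symm.toLinearMap ∘ₗ
    LinearMap.lTensor V (Coalgebra.comul (R := k) (A := C))

theorem assoc_cofree (V : Type) [AddCommGroup V] [Module k V] (x : V ⊗[k] C) :
    TensorProduct.assoc k V C C (cofree V x)
      = LinearMap.lTensor V (Coalgebra.comul (R := k) (A := C)) x := by
  simp [cofree]

theorem cofree_isComodule (V : Type) [AddCommGroup V] [Module k V] :
    IsComodule k C (cofree (k := k) (C := C) V) where
  coassoc := by
    ext v c
    apply (TensorProduct.assoc k V C (C ⊗[k] C)).injective
    have h1 : ∀ y : C ⊗[k] C, TensorProduct.assoc k V C (C ⊗[k] C)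
        (TensorProduct.assoc k (V ⊗[k] C) C C ((cofree V).rTensor C
          ((TensorProduct.assoc k V C C).symm (v ⊗ₜ y))))
        = v ⊗ₜ TensorProduct.assoc k C C C
          ((Coalgebra.comul (R := k) (A := C)).rTensor C y) := by
      intro y
      induction y with
      | zero => simp
      | add x y hx hy => simp [TensorProduct.tmul_add, hx, hy]
      | tmul a b =>
        simp only [TensorProduct.assoc_symm_tmul, LinearMap.rTensor_tmul, cofree,
          LinearMap.comp_apply, LinearEquiv.coe_coe, LinearMap.lTensor_tmul]
        induction (Coalgebra.comul (R := k) a) with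
        | zero => simp
        | add x y hx hy => simp [TensorProduct.tmul_add, TensorProduct.add_tmul, hx, hy]
        | tmul a b => simp
    have h2 : ∀ y : C ⊗[k] C, TensorProduct.assoc k V C (C ⊗[k] C)
        (LinearMap.lTensor (V ⊗[k] C) (Coalgebra.comul (R := k) (A := C))
          ((TensorProduct.assoc k V C C).symm (v ⊗ₜ y)))
        = v ⊗ₜ (Coalgebra.comul (R := k) (A := C)).lTensor C y := by
      intro y
      induction y with
      | zero => simp
      | add x y hx hy => simp [TensorProduct.tmul_add, hx, hy]
      | tmul a b => simp
    have e : cofree V (v ⊗ₜ[k] c) = (TensorProduct.assoc k V C C).symm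
        (v ⊗ₜ Coalgebra.comul (R := k) c) := by simp [cofree]
    change TensorProduct.assoc k V C (C ⊗[k] C)
        (TensorProduct.assoc k (V ⊗[k] C) C C ((cofree V).rTensor C (cofree V (v ⊗ₜ[k] c))))
      = TensorProduct.assoc k V C (C ⊗[k] C)
        (LinearMap.lTensor (V ⊗[k] C) (Coalgebra.comul (R := k) (A := C))
          (cofree V (v ⊗ₜ[k] c)))
    rw [e, h1, h2, Coalgebra.coassoc_apply]
  counit_id := by
    ext v c
    have h2 : ∀ y : C ⊗[k] C, act (Coalgebra.counit (R := k) (A := C))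
          ((TensorProduct.assoc k V C C).symm (v ⊗ₜ y))
        = v ⊗ₜ act (Coalgebra.counit (R := k) (A := C)) y := by
      intro y
      induction y with
      | zero => simp
      | add x y hx hy => simp [TensorProduct.tmul_add, hx, hy]
      | tmul a b => simp [act_tmul]
    have e : cofree V (v ⊗ₜ[k] c) = (TensorProduct.assoc k V C C).symm
        (v ⊗ₜ Coalgebra.comul (R := k) c) := by simp [cofree]
    change act (Coalgebra.counit (R := k) (A := C)) (cofree V (v ⊗ₜ[k] c)) = v ⊗ₜ c
    rw [e, h2, counit_ap self_isComodule]

theorem exists_retraction (M : Comod k C) (hM : IsInjectiveComod M) :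
    ∃ r : M.V ⊗[k] C →ₗ[k] M.V, IsComodHom (cofree M.V) M.β r ∧ ∀ v, r (M.β v) = v := by
  let P : Comod k C := ⟨M.V ⊗[k] C, cofree M.V, cofree_isComodule M.V⟩
  have hinj : Function.Injective M.β := by
    intro a b h
    rw [← counit_ap M.isComodule a, h, counit_ap M.isComodule b]
  have hβ : IsComodHom M.β P.β M.β := by
    ext1 v
    apply (TensorProduct.assoc k M.V C C).injective
    change TensorProduct.assoc k M.V C C (M.β.rTensor C (M.β v))
      = TensorProduct.assoc k M.V C C (cofree M.V (M.β v))
    rw [coassoc_ap M.isComodule, assoc_cofree]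
  obtain ⟨X, hX, hc⟩ := hM P M.β hβ hinj
  let r : M.V ⊗[k] C →ₗ[k] M.V := (LinearEquiv.ofInjective M.β hinj).symm.toLinearMap ∘ₗ
    Submodule.projectionOnto _ _ hc
  have hr1 : ∀ v, r (M.β v) = v := by
    intro v
    have : Submodule.projectionOnto _ _ hc (M.β v) = LinearEquiv.ofInjective M.β hinj v :=
      Submodule.projectionOnto_apply_left hc (LinearEquiv.ofInjective M.β hinj v)
    change (LinearEquiv.ofInjective M.β hinj).symm
      (Submodule.projectionOnto _ _ hc (M.β v)) = v
    rw [this]; simp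
  have hr2 : ∀ x ∈ X, r x = 0 := by
    intro x hx
    have : Submodule.projectionOnto _ _ hc x = 0 :=
      Submodule.projectionOnto_apply_right hc ⟨x, hx⟩
    change (LinearEquiv.ofInjective M.β hinj).symm
      (Submodule.projectionOnto _ _ hc x) = 0
    rw [this]; simp
  refine ⟨r, ?_, hr1⟩
  refine LinearMap.ext fun w => ?_
  change r.rTensor C (cofree M.V w) = M.β (r w)
  have hw : w ∈ LinearMap.range M.β ⊔ X := by rw [hc.sup_eq_top]; trivial
  obtain ⟨_, ⟨v, rfl⟩, x, hx, rfl⟩ := Submodule.mem_sup.1 hw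
  have a1 : r.rTensor C (cofree M.V (M.β v)) = M.β v := by
    have := LinearMap.congr_fun hβ v
    change M.β.rTensor C (M.β v) = cofree M.V (M.β v) at this
    rw [← this, ← LinearMap.comp_apply, ← LinearMap.rTensor_comp,
      show r ∘ₗ M.β = LinearMap.id from LinearMap.ext hr1]
    simp
  have a2 : r.rTensor C (cofree M.V x) = 0 := by
    obtain ⟨y, hy⟩ := hX x hx
    change _ = cofree M.V x at hy
    rw [← hy]
    change (r.rTensor C ∘ₗ X.subtype.rTensor C) y = 0
    rw [← LinearMap.rTensor_comp, show r ∘ₗ X.subtype = 0 from LinearMap.ext fun x => hr2 x x.2]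
    simp
  rw [map_add, map_add, map_add, map_add, a1, a2, hr1, hr2 x hx]; simp

theorem exists_extension {V : Type} [AddCommGroup V] [Module k V] {β : V →ₗ[k] V ⊗[k] C}
    (hβ : IsComodule k C β) (S : Submodule k V) (γ : S →ₗ[k] S ⊗[k] C)
    (hγ : ∀ w : S, S.subtype.rTensor C (γ w) = β w)
    (M : Comod k C) (hM : IsInjectiveComod M) (g : S →ₗ[k] M.V) (hg : IsComodHom γ M.β g) :
    ∃ f : V →ₗ[k] M.V, IsComodHom β M.β f ∧ ∀ s : S, f s = g s := by
  obtain ⟨r, hr, hr1⟩ := exists_retraction M hM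
  obtain ⟨g', hg'⟩ := LinearMap.exists_extend g
  refine ⟨r ∘ₗ g'.rTensor C ∘ₗ β, ?_, ?_⟩
  · ext1 v
    change (r ∘ₗ g'.rTensor C ∘ₗ β).rTensor C (β v) = M.β (r (g'.rTensor C (β v)))
    rw [← LinearMap.comp_apply M.β r, ← hr, LinearMap.rTensor_comp, LinearMap.rTensor_comp]
    simp only [LinearMap.comp_apply]
    congr 1
    apply (TensorProduct.assoc k M.V C C).injective
    rw [assoc_cofree, ← assoc_nat, coassoc_ap hβ, lr_comm]
  · intro s
    change r (g'.rTensor C (β s)) = g s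
    rw [← hγ, ← LinearMap.comp_apply (g'.rTensor C), ← LinearMap.rTensor_comp, hg',
      ← LinearMap.comp_apply (g.rTensor C), hg, LinearMap.comp_apply, hr1]

theorem isSub_iff {V : Type} [AddCommGroup V] [Module k V] (β : V →ₗ[k] V ⊗[k] C)
    (W : Submodule k V) : IsSubcomodule β W ↔ ∀ w ∈ W, ∀ f : C →ₗ[k] k, act f (β w) ∈ W :=
  forall₂_congr fun _ _ => mem_range_iff _ _

theorem exists_fg (V : Type) [AddCommGroup V] [Module k V] (x : V ⊗[k] C) :
    ∃ W : Submodule k V, FiniteDimensional k W ∧ x ∈ LinearMap.range (W.subtype.rTensor C) := by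
  induction x with
  | zero => exact ⟨⊥, inferInstance, zero_mem _⟩
  | tmul v d =>
    exact ⟨k ∙ v, inferInstance, ⟨⟨v, Submodule.mem_span_singleton_self v⟩ ⊗ₜ d, by simp⟩⟩
  | add x y hx hy =>
    obtain ⟨A, _, hA⟩ := hx
    obtain ⟨B, _, hB⟩ := hy
    refine ⟨A ⊔ B, inferInstance, ?_⟩
    rw [mem_range_iff] at *
    intro f
    rw [map_add]
    exact add_mem (Submodule.mem_sup_left (hA f)) (Submodule.mem_sup_right (hB f))

theorem exists_fd_sub {V : Type} [AddCommGroup V] [Module k V] {β : V →ₗ[k] V ⊗[k] C}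
    (hβ : IsComodule k C β) (v : V) :
    ∃ W : Submodule k V, FiniteDimensional k W ∧ IsSubcomodule β W ∧ v ∈ W ∧
      ∀ U : Submodule k V, IsSubcomodule β U → v ∈ U → W ≤ U := by
  let T : (C →ₗ[k] k) →ₗ[k] V :=
    { toFun := fun f => act f (β v)
      map_add' := fun f g => by simp [act, LinearMap.lTensor_add]
      map_smul' := fun c f => by simp [act, LinearMap.lTensor_smul] }
  refine ⟨LinearMap.range T, ?_, ?_, ⟨Coalgebra.counit, counit_ap hβ v⟩, ?_⟩
  · obtain ⟨A, _, hA⟩ := exists_fg (C := C) V (β v)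
    rw [mem_range_iff] at hA
    exact Submodule.finiteDimensional_of_le (S₂ := A) (by rintro _ ⟨f, rfl⟩; exact hA f)
  · rw [isSub_iff]
    rintro _ ⟨f, rfl⟩ f'
    let g : C ⊗[k] C →ₗ[k] k := LinearMap.mul' k k ∘ₗ TensorProduct.map f' f
    refine ⟨g ∘ₗ Coalgebra.comul, ?_⟩
    change act (g ∘ₗ Coalgebra.comul) (β v) = act f' (β (act f (β v)))
    have h1 : act (g ∘ₗ Coalgebra.comul) (β v)
        = act g (LinearMap.lTensor V (Coalgebra.comul (R := k) (A := C)) (β v)) := by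
      simp [act, LinearMap.lTensor_comp]
    rw [h1, ← coassoc_ap hβ]
    have h2 : ∀ y : (V ⊗[k] C) ⊗[k] C, act g (TensorProduct.assoc k V C C y)
        = act f' (act f y) := by
      intro y
      have : act g ∘ₗ (TensorProduct.assoc k V C C).toLinearMap = act f' ∘ₗ act f := by
        ext a b c
        simp [act_tmul, g, smul_smul, mul_comm]
      exact LinearMap.congr_fun this y
    rw [h2, act_rTensor]
  · rintro U hU hv _ ⟨f, rfl⟩
    exact (isSub_iff _ _).1 hU v hv f

theorem exists_simple {V : Type} [AddCommGroup V] [Module k V] {β : V →ₗ[k] V ⊗[k] C}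
    (hβ : IsComodule k C β) (K : Submodule k V) (hK : IsSubcomodule β K) (h0 : K ≠ ⊥) :
    ∃ S ≤ K, IsSimpleSubcomodule β S := by
  classical
  have hex : ∃ n, ∃ W : Submodule k V, W ≤ K ∧ IsSubcomodule β W ∧ W ≠ ⊥ ∧
      FiniteDimensional k W ∧ Module.finrank k W = n := by
    obtain ⟨v, hv, hv0⟩ := Submodule.exists_mem_ne_zero_of_ne_bot h0
    obtain ⟨W, hf, hW, hvW, hle⟩ := exists_fd_sub hβ v
    exact ⟨_, W, hle K hK hv, hW, fun h => hv0 (by simpa [h] using hvW), hf, rfl⟩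
  obtain ⟨W, hWK, hW, hW0, hf, hn⟩ := Nat.find_spec hex
  refine ⟨W, hWK, hW, hW0, fun U hU hUs => ?_⟩
  by_cases hU0 : U = ⊥
  · exact Or.inl hU0
  · right
    haveI : FiniteDimensional k U := Submodule.finiteDimensional_of_le hU
    have := Nat.find_min' hex ⟨U, hU.trans hWK, hUs, hU0, this, rfl⟩
    exact Submodule.eq_of_le_of_finrank_le hU (hn.le.trans this)

theorem simple_restrict {V : Type} [AddCommGroup V] [Module k V] {β : V →ₗ[k] V ⊗[k] C}
    (S : Submodule k V) (hS : IsSimpleSubcomodule β S) (γ : S →ₗ[k] S ⊗[k] C)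
    (hc : IsComodule k C γ) (hγ : ∀ w : S, S.subtype.rTensor C (γ w) = β w) :
    IsSimpleComod (⟨S, γ, hc⟩ : Comod k C) := by
  refine ⟨(Submodule.nontrivial_iff_ne_bot).2 hS.2.1, fun (W : Submodule k S) hW => ?_⟩
  have hW' : IsSubcomodule β (W.map S.subtype) := by
    rw [isSub_iff] at hW ⊢
    rintro _ ⟨w, hw, rfl⟩ f
    refine ⟨act f (γ w), hW w hw f, ?_⟩
    rw [← act_rTensor, hγ]; rfl
  rcases hS.2.2 _ (Submodule.map_subtype_le S W) hW' with h | h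
  · left
    apply Submodule.map_injective_of_injective S.subtype_injective
    rw [h]; simp
  · right
    apply Submodule.map_injective_of_injective S.subtype_injective
    rw [h]; simp

theorem coeffMap_tmul {V : Type} [AddCommGroup V] [Module k V] (β : V →ₗ[k] V ⊗[k] C)
    (ω : Module.Dual k V) (v : V) :
    coeffMap β (ω ⊗ₜ v) = TensorProduct.lid k C (ω.rTensor C (β v)) := by
  simp only [coeffMap, LinearMap.comp_apply, LinearMap.lTensor_tmul, LinearEquiv.coe_coe]
  induction (β v) with
  | zero => simp
  | tmul a b => simp
  | add x y hx hy => rw [TensorProduct.tmul_add]; simp only [map_add, hx, hy]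

/-- Let `F₀` be a full set of simple `C`-comodules (one from each isomorphism class) and
`F` a corresponding set of indecomposable injective covers.  Then `C` is spanned by the
coefficients of the members of `F`:  `C = Σ_{I ∈ F} φ_I (I* ⊗ I)`. -/
theorem coalgebra_spanned_by_injective_coefficients
    {ι : Type} (F₀ F : ι → Comod k C)
    (hsimple : ∀ i, IsSimpleComod (F₀ i))
    (hfull : ∀ M : Comod k C, IsSimpleComod M →
      ∃ i, ∃ e : M.V ≃ₗ[k] (F₀ i).V, IsComodHom M.β (F₀ i).β e.toLinearMap)
    (hsep : ∀ i j, (∃ e : (F₀ i).V ≃ₗ[k] (F₀ j).V,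
      IsComodHom (F₀ i).β (F₀ j).β e.toLinearMap) → i = j)
    (hcover : ∀ i, IsInjectiveCover (F i) (F₀ i)) :
    (⨆ i, LinearMap.range (coeffMap (F i).β)) = (⊤ : Submodule k C) := by
  classical
  -- the forms factoring through comodule maps to members of `F`
  let D : Submodule k (Module.Dual k C) := Submodule.span k
    {η | ∃ i, ∃ f : C →ₗ[k] (F i).V, IsComodHom Coalgebra.comul (F i).β f ∧
      ∃ ω : Module.Dual k (F i).V, η = ω ∘ₗ f}
  let K : Submodule k C := D.dualCoannihilator
  have hKf : ∀ i, ∀ f : C →ₗ[k] (F i).V, IsComodHom Coalgebra.comul (F i).β f →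
      ∀ c ∈ K, f c = 0 := by
    intro i f hf c hc
    rw [← Module.forall_dual_apply_eq_zero_iff k]
    intro ω
    exact (Submodule.mem_dualCoannihilator _ ).1 hc _ (Submodule.subset_span ⟨i, f, hf, ω, rfl⟩)
  have hKs : IsSubcomodule (Coalgebra.comul (R := k) (A := C)) K := by
    rw [isSub_iff]
    intro c hc φ
    refine (Submodule.mem_dualCoannihilator _ ).2 fun η hη => ?_
    induction hη using Submodule.span_induction with
    | zero => simp
    | add x y _ _ hx hy => simp [hx, hy]
    | smul a x _ hx => simp [hx]
    | mem x hx =>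
      obtain ⟨i, f, hf, ω, rfl⟩ := hx
      rw [LinearMap.comp_apply, ← act_rTensor, ← LinearMap.comp_apply (f.rTensor C), hf,
        LinearMap.comp_apply, hKf i f hf c hc]
      simp
  have hK0 : K = ⊥ := by
    by_contra h0
    obtain ⟨S, hSK, hS⟩ := exists_simple self_isComodule K hKs h0
    obtain ⟨γ, hγc, hγ⟩ := exists_restrict self_isComodule S hS.1
    obtain ⟨i, e, he⟩ := hfull _ (simple_restrict S hS γ hγc hγ)
    obtain ⟨-, hinj, g, hg, hgi, -⟩ := hcover i
    have hge : IsComodHom γ (F i).β (g ∘ₗ e.toLinearMap) := by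
      unfold IsComodHom at *
      rw [LinearMap.rTensor_comp, LinearMap.comp_assoc, he, ← LinearMap.comp_assoc, hg,
        LinearMap.comp_assoc]
    obtain ⟨f, hf, hfs⟩ := exists_extension self_isComodule S γ hγ (F i) hinj _ hge
    obtain ⟨s, hs, hs0⟩ := Submodule.exists_mem_ne_zero_of_ne_bot hS.2.1
    have h1 : g (e (⟨s, hs⟩ : S)) = 0 := by
      have := hfs ⟨s, hs⟩
      rw [hKf i f hf s (hSK hs)] at this
      exact this.symm
    have h2 : e (⟨s, hs⟩ : S) = 0 := hgi (by rw [h1, map_zero])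
    have h3 : (⟨s, hs⟩ : S) = 0 := e.injective (by rw [h2]; exact (map_zero e).symm)
    exact hs0 (congrArg Subtype.val h3)
  rw [eq_top_iff]
  rintro c -
  obtain ⟨M, hM, y, hy⟩ := exists_fg (C := C) C (Coalgebra.comul (R := k) c)
  -- restriction to `M`
  let ρ : Module.Dual k C →ₗ[k] Module.Dual k M := M.subtype.dualMap
  have hD : D.map ρ = ⊤ := by
    have h1 : (D.map ρ).dualCoannihilator = ⊥ := by
      rw [eq_bot_iff]
      intro m hm
      have : (m : C) ∈ K := (Submodule.mem_dualCoannihilator _ ).2 fun η hη =>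
        (Submodule.mem_dualCoannihilator _ ).1 hm (ρ η) ⟨η, hη, rfl⟩
      rw [hK0] at this
      simpa using this
    rw [← Subspace.dualCoannihilator_dualAnnihilator_eq (W := D.map ρ), h1]
    simp
  obtain ⟨η, hη, hηε⟩ : ρ (Coalgebra.counit (R := k) (A := C)) ∈ D.map ρ := by
    rw [hD]; trivial
  have hc : c = TensorProduct.lid k C (η.rTensor C (Coalgebra.comul (R := k) c)) := by
    have e1 : c = TensorProduct.lid k C ((Coalgebra.counit (R := k) (A := C)).rTensor C
      (Coalgebra.comul (R := k) c)) := by simp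
    have e2 : ∀ θ : Module.Dual k C, θ.rTensor C (M.subtype.rTensor C y)
        = (ρ θ).rTensor C y := by
      intro θ
      rw [← LinearMap.comp_apply, ← LinearMap.rTensor_comp]; rfl
    rw [← hy, e2, hηε, ← e2, hy]
    exact e1
  rw [hc]
  clear hc hηε
  induction hη using Submodule.span_induction with
  | zero => simp
  | add x y _ _ hx hy => rw [LinearMap.rTensor_add, LinearMap.add_apply, map_add]; exact add_mem hx hy
  | smul a x _ hx =>
    rw [LinearMap.rTensor_smul, LinearMap.smul_apply, map_smul]; exact Submodule.smul_mem _ _ hx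
  | mem x hx =>
    obtain ⟨i, f, hf, ω, rfl⟩ := hx
    refine Submodule.mem_iSup_of_mem i ⟨ω ⊗ₜ f c, ?_⟩
    rw [coeffMap_tmul, ← LinearMap.comp_apply (F i).β f, ← hf, LinearMap.comp_apply,
      LinearMap.rTensor_comp, LinearMap.comp_apply]

end SuperCoalg
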